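/- Let N ≥ 1, let k₁,…,k_N be nonzero real constants, and let u, v : ℝ^N → ℝ be C^∞ functions. Then □³(u·v) = Σ_{α=0}^{3} C(3,α)·(□^{3−α}u)·(□^α v) + 6·Σ_{α=0}^{2} C(2,α)·◊(□^{2−α}u, □^α v) + 12·Σ_{α=0}^{1} C(1,α)·◊²(□^{1−α}u, □^α v) + 8·◊³(u,v), where □³ denotes □ applied three times and C(n,α) is the binomial coefficient. -/

import Mathlib

variable {N : ℕ}

/-- Partial derivative in the `i`-th coordinate direction. -/
noncomputable def pd (i : Fin N) (f : (Fin N → ℝ) → ℝ) : (Fin N → ℝ) → ℝ :=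
  fun x => fderiv ℝ f x (Pi.single i 1)

/-- Iterated partial derivative along a list of coordinate directions. -/
noncomputable def mpd : List (Fin N) → ((Fin N → ℝ) → ℝ) → ((Fin N → ℝ) → ℝ)
  | [], f => f
  | i :: l, f => pd i (mpd l f)

/-- The operator `□w = Σ_{i=1}^N (1/k_i) ∂²w/∂x_i²`. -/
noncomputable def box (k : Fin N → ℝ) (f : (Fin N → ℝ) → ℝ) : (Fin N → ℝ) → ℝ :=
  fun x => ∑ i : Fin N, (1 / k i) * pd i (pd i f) x

/-- The bilinear operator
`◊^m(u,v) = Σ_{i₁,…,i_m} (1/(k_{i₁}⋯k_{i_m})) (∂^m u/∂x_{i₁}⋯∂x_{i_m})·(∂^m v/∂x_{i₁}⋯∂x_{i_m})`. -/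
noncomputable def diam (k : Fin N → ℝ) (m : ℕ) (u v : (Fin N → ℝ) → ℝ) :
    (Fin N → ℝ) → ℝ :=
  fun x => ∑ ι : Fin m → Fin N,
    (∏ j : Fin m, 1 / k (ι j)) * mpd (List.ofFn ι) u x * mpd (List.ofFn ι) v x

theorem ContDiff.pd {f : (Fin N → ℝ) → ℝ} (hf : ContDiff ℝ (⊤ : ℕ∞) f) (i : Fin N) :
    ContDiff ℝ (⊤ : ℕ∞) (pd i f) :=
  (hf.fderiv_right (m := (⊤ : ℕ∞)) (by simp)).clm_apply contDiff_const

theorem ContDiff.mpd {f : (Fin N → ℝ) → ℝ} (hf : ContDiff ℝ (⊤ : ℕ∞) f) (l : List (Fin N)) :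
    ContDiff ℝ (⊤ : ℕ∞) (mpd l f) := by
  induction l with
  | nil => exact hf
  | cons i l ih => exact ih.pd i

theorem ContDiff.box {f : (Fin N → ℝ) → ℝ} (hf : ContDiff ℝ (⊤ : ℕ∞) f) (k : Fin N → ℝ) :
    ContDiff ℝ (⊤ : ℕ∞) (box k f) :=
  ContDiff.sum fun i _ => contDiff_const.mul ((hf.pd i).pd i)

theorem ContDiff.diam {u v : (Fin N → ℝ) → ℝ} (hu : ContDiff ℝ (⊤ : ℕ∞) u)
    (hv : ContDiff ℝ (⊤ : ℕ∞) v) (k : Fin N → ℝ) (m : ℕ) :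
    ContDiff ℝ (⊤ : ℕ∞) (diam k m u v) :=
  ContDiff.sum fun _ _ => (contDiff_const.mul (hu.mpd _)).mul (hv.mpd _)

theorem ContDiff.differentiable_of_top {f : (Fin N → ℝ) → ℝ} (hf : ContDiff ℝ (⊤ : ℕ∞) f) :
    Differentiable ℝ f :=
  hf.differentiable (by simp)

theorem pd_comm {f : (Fin N → ℝ) → ℝ} (hf : ContDiff ℝ (⊤ : ℕ∞) f) (i j : Fin N) :
    pd i (pd j f) = pd j (pd i f) := by
  have hd : Differentiable ℝ (fderiv ℝ f) :=
    (hf.fderiv_right (m := (⊤ : ℕ∞)) (by simp)).differentiable (by simp)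
  have key (a b : Fin N) (x : Fin N → ℝ) :
      pd a (pd b f) x = fderiv ℝ (fderiv ℝ f) x (Pi.single a 1) (Pi.single b 1) := by
    unfold pd
    rw [fderiv_clm_apply (hd x) (differentiableAt_const _)]
    simp
  ext x
  rw [key, key]
  refine (hf.contDiffAt.isSymmSndFDerivAt ?_).eq _ _
  rw [minSmoothness_of_isRCLikeNormedField]
  exact WithTop.coe_le_coe.2 (le_top : (2 : ℕ∞) ≤ ⊤)

theorem pd_add {f g : (Fin N → ℝ) → ℝ} (hf : Differentiable ℝ f) (hg : Differentiable ℝ g)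
    (i : Fin N) : pd i (fun x => f x + g x) = fun x => pd i f x + pd i g x := by
  ext x
  simp [pd, fderiv_fun_add (hf x) (hg x)]

theorem pd_mul {f g : (Fin N → ℝ) → ℝ} (hf : Differentiable ℝ f) (hg : Differentiable ℝ g)
    (i : Fin N) : pd i (fun x => f x * g x) = fun x => pd i f x * g x + f x * pd i g x := by
  ext x
  simp [pd, fderiv_fun_mul (hf x) (hg x)]
  ring

theorem pd_const_mul {f : (Fin N → ℝ) → ℝ} (hf : Differentiable ℝ f) (c : ℝ) (i : Fin N) :
    pd i (fun x => c * f x) = fun x => c * pd i f x := by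
  ext x
  simp [pd, fderiv_const_mul (hf x)]

theorem pd_sum {ι : Type*} (s : Finset ι) {f : ι → (Fin N → ℝ) → ℝ}
    (hf : ∀ j, Differentiable ℝ (f j)) (i : Fin N) :
    pd i (fun x => ∑ j ∈ s, f j x) = fun x => ∑ j ∈ s, pd i (f j) x := by
  ext x
  simp [pd, fderiv_fun_sum fun j _ => hf j x]

theorem pd_box {f : (Fin N → ℝ) → ℝ} (hf : ContDiff ℝ (⊤ : ℕ∞) f) (k : Fin N → ℝ) (i : Fin N) :
    pd i (box k f) = box k (pd i f) := by
  have hd (j : Fin N) : Differentiable ℝ (pd j (pd j f)) :=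
    ((hf.pd j).pd j).differentiable_of_top
  unfold box
  rw [pd_sum _ fun j => (hd j).const_mul _]
  ext x
  refine Finset.sum_congr rfl fun j _ => ?_
  rw [pd_const_mul (hd j), pd_comm (hf.pd j), pd_comm hf]

theorem mpd_box {f : (Fin N → ℝ) → ℝ} (hf : ContDiff ℝ (⊤ : ℕ∞) f) (k : Fin N → ℝ)
    (l : List (Fin N)) : mpd l (box k f) = box k (mpd l f) := by
  induction l with
  | nil => rfl
  | cons i l ih => simp only [mpd, ih, pd_box (hf.mpd l)]

theorem box_add {f g : (Fin N → ℝ) → ℝ} (hf : ContDiff ℝ (⊤ : ℕ∞) f)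
    (hg : ContDiff ℝ (⊤ : ℕ∞) g) (k : Fin N → ℝ) :
    box k (fun x => f x + g x) = fun x => box k f x + box k g x := by
  ext x
  simp only [box, ← Finset.sum_add_distrib]
  refine Finset.sum_congr rfl fun i _ => ?_
  rw [pd_add hf.differentiable_of_top hg.differentiable_of_top,
    pd_add (hf.pd i).differentiable_of_top (hg.pd i).differentiable_of_top]
  ring

theorem box_const_mul {f : (Fin N → ℝ) → ℝ} (hf : ContDiff ℝ (⊤ : ℕ∞) f) (k : Fin N → ℝ)
    (c : ℝ) : box k (fun x => c * f x) = fun x => c * box k f x := by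
  ext x
  simp only [box, Finset.mul_sum]
  refine Finset.sum_congr rfl fun i _ => ?_
  rw [pd_const_mul hf.differentiable_of_top, pd_const_mul (hf.pd i).differentiable_of_top]
  ring

theorem box_sum {ι : Type*} (s : Finset ι) {f : ι → (Fin N → ℝ) → ℝ}
    (hf : ∀ j, ContDiff ℝ (⊤ : ℕ∞) (f j)) (k : Fin N → ℝ) :
    box k (fun x => ∑ j ∈ s, f j x) = fun x => ∑ j ∈ s, box k (f j) x := by
  ext x
  simp only [box]
  rw [Finset.sum_comm]
  refine Finset.sum_congr rfl fun i _ => ?_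
  rw [pd_sum s fun j => (hf j).differentiable_of_top,
    pd_sum s fun j => ((hf j).pd i).differentiable_of_top, Finset.mul_sum]

theorem box_mul {f g : (Fin N → ℝ) → ℝ} (hf : ContDiff ℝ (⊤ : ℕ∞) f)
    (hg : ContDiff ℝ (⊤ : ℕ∞) g) (k : Fin N → ℝ) :
    box k (fun x => f x * g x) = fun x =>
      box k f x * g x + f x * box k g x + 2 * ∑ i, 1 / k i * pd i f x * pd i g x := by
  ext x
  simp only [box, Finset.mul_sum, Finset.sum_mul, ← Finset.sum_add_distrib]
  refine Finset.sum_congr rfl fun i _ => ?_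
  have hf₀ := hf.differentiable_of_top
  have hg₀ := hg.differentiable_of_top
  have hf₁ := (hf.pd i).differentiable_of_top
  have hg₁ := (hg.pd i).differentiable_of_top
  rw [pd_mul hf₀ hg₀, pd_add (hf₁.fun_mul hg₀) (hf₀.fun_mul hg₁), pd_mul hf₁ hg₀, pd_mul hf₀ hg₁]
  ring

theorem diam_zero (k : Fin N → ℝ) (u v : (Fin N → ℝ) → ℝ) :
    diam k 0 u v = fun x => u x * v x := by
  ext x
  simp [diam, mpd]

theorem diam_succ (k : Fin N → ℝ) (m : ℕ) (u v : (Fin N → ℝ) → ℝ) (x : Fin N → ℝ) :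
    diam k (m + 1) u v x = ∑ ι : Fin m → Fin N, (∏ j, 1 / k (ι j)) *
      ∑ i, 1 / k i * pd i (mpd (List.ofFn ι) u) x * pd i (mpd (List.ofFn ι) v) x := by
  simp only [diam, Finset.mul_sum]
  rw [← (Fin.consEquiv fun _ => Fin N).sum_comp, Fintype.sum_prod_type, Finset.sum_comm]
  refine Finset.sum_congr rfl fun ι _ => Finset.sum_congr rfl fun i _ => ?_
  simp only [Fin.consEquiv_apply, Fin.prod_univ_succ, List.ofFn_succ, Fin.cons_zero,
    Fin.cons_succ, mpd]
  ring

/-- The Leibniz rule for `□` on `◊^m(u,v)`. -/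
theorem box_diam {u v : (Fin N → ℝ) → ℝ} (hu : ContDiff ℝ (⊤ : ℕ∞) u)
    (hv : ContDiff ℝ (⊤ : ℕ∞) v) (k : Fin N → ℝ) (m : ℕ) :
    box k (diam k m u v) = fun x =>
      diam k m (box k u) v x + diam k m u (box k v) x + 2 * diam k (m + 1) u v x := by
  have hdiam : diam k m u v = fun x => ∑ ι : Fin m → Fin N,
      (∏ j, 1 / k (ι j)) * (mpd (List.ofFn ι) u x * mpd (List.ofFn ι) v x) := by
    ext x
    simp only [diam, mul_assoc]
  have hmul (l : List (Fin N)) : ContDiff ℝ (⊤ : ℕ∞) fun x => mpd l u x * mpd l v x :=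
    (hu.mpd l).mul (hv.mpd l)
  rw [hdiam, box_sum _ fun ι => contDiff_const.mul (hmul _)]
  ext x
  rw [diam_succ, Finset.mul_sum]
  simp only [diam]
  rw [← Finset.sum_add_distrib, ← Finset.sum_add_distrib]
  refine Finset.sum_congr rfl fun ι _ => ?_
  rw [box_const_mul (hmul _), box_mul (hu.mpd _) (hv.mpd _), mpd_box hu, mpd_box hv]
  ring

theorem box_add_add_two_mul {f g h : (Fin N → ℝ) → ℝ} (hf : ContDiff ℝ (⊤ : ℕ∞) f)
    (hg : ContDiff ℝ (⊤ : ℕ∞) g) (hh : ContDiff ℝ (⊤ : ℕ∞) h) (k : Fin N → ℝ) :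
    box k (fun x => f x + g x + 2 * h x) = fun x => box k f x + box k g x + 2 * box k h x := by
  rw [box_add (hf.add hg) (contDiff_const.mul hh), box_add hf hg, box_const_mul hh]

/-- The Leibniz rule for `□²` on `◊^m(u,v)`. -/
theorem box_box_diam {u v : (Fin N → ℝ) → ℝ} (hu : ContDiff ℝ (⊤ : ℕ∞) u)
    (hv : ContDiff ℝ (⊤ : ℕ∞) v) (k : Fin N → ℝ) (m : ℕ) :
    box k (box k (diam k m u v)) = fun x =>
      box k (diam k m (box k u) v) x + box k (diam k m u (box k v)) x +
        2 * box k (diam k (m + 1) u v) x := by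
  rw [box_diam hu hv, box_add_add_two_mul ((hu.box k).diam hv k m) (hu.diam (hv.box k) k m)
    (hu.diam hv k (m + 1))]

/-- The `n = 3` case of the Leibniz-type formula of Proposition 2.2. -/
theorem box_cube_mul (hN : 1 ≤ N) (k : Fin N → ℝ) (hk : ∀ i, k i ≠ 0)
    (u v : (Fin N → ℝ) → ℝ) (hu : ContDiff ℝ (⊤ : ℕ∞) u) (hv : ContDiff ℝ (⊤ : ℕ∞) v) :
    (box k)^[3] (fun x => u x * v x) =
      fun x =>
        (∑ α ∈ Finset.range 4,
          (Nat.choose 3 α : ℝ) * (box k)^[3 - α] u x * (box k)^[α] v x) +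
        6 * (∑ α ∈ Finset.range 3,
          (Nat.choose 2 α : ℝ) * diam k 1 ((box k)^[2 - α] u) ((box k)^[α] v) x) +
        12 * (∑ α ∈ Finset.range 2,
          (Nat.choose 1 α : ℝ) * diam k 2 ((box k)^[1 - α] u) ((box k)^[α] v) x) +
        8 * diam k 3 u v x := by
  rw [← diam_zero k u v]
  simp only [Function.iterate_succ, Function.iterate_zero, Function.comp_apply, id_eq,
    Finset.sum_range_succ, Finset.sum_range_zero]
  have hu₁ := hu.box k
  have hv₁ := hv.box k
  have hu₂ := hu₁.box k
  have hv₂ := hv₁.box k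
  rw [box_box_diam hu hv, box_add_add_two_mul ((hu₁.diam hv k 0).box k)
    ((hu.diam hv₁ k 0).box k) ((hu.diam hv k 1).box k), box_box_diam hu₁ hv,
    box_box_diam hu hv₁, box_box_diam hu hv]
  ext x
  simp only [box_diam hu hv, box_diam hu₁ hv, box_diam hu hv₁, box_diam hu₁ hv₁,
    box_diam hu₂ hv, box_diam hu hv₂]
  norm_num [Nat.choose, diam_zero]
  ring
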